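/- For every V ∈ ℝ^{n×d}, every s, s' ∈ ℝ^d, and every U, U' ∈ ℝ^{m×d}, the gradient of g with respect to U satisfies ‖∇_U g(V,U,s) − ∇_U g(V,U',s')‖_F ≤ √m · ((1+α₀)‖V‖_F² + λ̄_U) · ‖U − U'‖_F. -/

import Mathlib

open Matrix Finset Filter Topology

noncomputable section

/-- Squared Frobenius norm of a real matrix. -/
def frobSq {a b : ℕ} (A : Matrix (Fin a) (Fin b) ℝ) : ℝ := ∑ i, ∑ j, (A i j) ^ 2

/-- Frobenius norm of a real matrix. -/
def frobNorm {a b : ℕ} (A : Matrix (Fin a) (Fin b) ℝ) : ℝ := Real.sqrt (frobSq A)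

/-- Frobenius (trace) inner product of matrices. -/
def frobInner {a b : ℕ} (A B : Matrix (Fin a) (Fin b) ℝ) : ℝ := ∑ i, ∑ j, A i j * B i j

/-- Squared Euclidean norm of a vector. -/
def vecSq {a : ℕ} (x : Fin a → ℝ) : ℝ := ∑ i, (x i) ^ 2

/-- Euclidean norm of a vector. -/
def vecNorm {a : ℕ} (x : Fin a → ℝ) : ℝ := Real.sqrt (vecSq x)

/-- Entrywise (Hadamard) product of matrices. -/
def hprod {a b : ℕ} (A B : Matrix (Fin a) (Fin b) ℝ) : Matrix (Fin a) (Fin b) ℝ :=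
  Matrix.of fun i j => A i j * B i j

/-- The iALS loss L(V,U). -/
def iALSLoss {m n d : ℕ} (R : Matrix (Fin m) (Fin n) ℝ) (α₀ : ℝ)
    (lamU : Fin m → ℝ) (lamV : Fin n → ℝ)
    (V : Matrix (Fin n) (Fin d) ℝ) (U : Matrix (Fin m) (Fin d) ℝ) : ℝ :=
  (1/2) * frobSq (hprod R (R - U * Vᵀ)) + (α₀/2) * frobSq (U * Vᵀ)
    + (1/2) * ∑ i, lamU i * vecSq (U i) + (1/2) * ∑ j, lamV j * vecSq (V j)

/-- g(V,U,s) = L(V,U) + (λ_ex/2)‖V s‖₂². -/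
def gFun {m n d : ℕ} (R : Matrix (Fin m) (Fin n) ℝ) (α₀ lamex : ℝ)
    (lamU : Fin m → ℝ) (lamV : Fin n → ℝ)
    (V : Matrix (Fin n) (Fin d) ℝ) (U : Matrix (Fin m) (Fin d) ℝ) (s : Fin d → ℝ) : ℝ :=
  iALSLoss R α₀ lamU lamV V U + (lamex/2) * vecSq (V.mulVec s)

/-- (1/m) Uᵀ 𝟙 : the average of the rows of U. -/
def avgRow {m d : ℕ} (U : Matrix (Fin m) (Fin d) ℝ) : Fin d → ℝ :=
  fun k => (1 / (m : ℝ)) * ∑ i, U i k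

/-- The augmented Lagrangian L_ρ(V,U,s,w). -/
def augL {m n d : ℕ} (R : Matrix (Fin m) (Fin n) ℝ) (α₀ lamex : ℝ)
    (lamU : Fin m → ℝ) (lamV : Fin n → ℝ) (ρ : ℝ)
    (V : Matrix (Fin n) (Fin d) ℝ) (U : Matrix (Fin m) (Fin d) ℝ) (s w : Fin d → ℝ) : ℝ :=
  gFun R α₀ lamex lamU lamV V U s + (ρ/2) * vecSq (avgRow U - s + w) - (ρ/2) * vecSq w

/-- Gradient of g with respect to V; the j-th row is
(Σ_i R_{ij} u_i u_iᵀ + α₀ UᵀU + λ_ex s sᵀ + λ_V^{(j)} I) v_j − Σ_i R_{ij} u_i. -/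
def gradV {m n d : ℕ} (R : Matrix (Fin m) (Fin n) ℝ) (α₀ lamex : ℝ)
    (lamV : Fin n → ℝ)
    (V : Matrix (Fin n) (Fin d) ℝ) (U : Matrix (Fin m) (Fin d) ℝ) (s : Fin d → ℝ) :
    Matrix (Fin n) (Fin d) ℝ :=
  Matrix.of fun j =>
    ((∑ i, R i j • vecMulVec (U i) (U i)) + α₀ • (Uᵀ * U)
        + lamex • vecMulVec s s + (lamV j) • (1 : Matrix (Fin d) (Fin d) ℝ)).mulVec (V j)
      - ∑ i, R i j • U i

/-- Gradient of g with respect to U; the i-th row is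
(Σ_j R_{ij} v_j v_jᵀ + α₀ VᵀV + λ_U^{(i)} I) u_i − Σ_j R_{ij} v_j (independent of s). -/
def gradU {m n d : ℕ} (R : Matrix (Fin m) (Fin n) ℝ) (α₀ : ℝ)
    (lamU : Fin m → ℝ)
    (V : Matrix (Fin n) (Fin d) ℝ) (U : Matrix (Fin m) (Fin d) ℝ) :
    Matrix (Fin m) (Fin d) ℝ :=
  Matrix.of fun i =>
    ((∑ j, R i j • vecMulVec (V j) (V j)) + α₀ • (Vᵀ * V)
        + (lamU i) • (1 : Matrix (Fin d) (Fin d) ℝ)).mulVec (U i)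
      - ∑ j, R i j • V j

/-- Gradient of g with respect to s: λ_ex VᵀV s (independent of U). -/
def gradS {n d : ℕ} (lamex : ℝ) (V : Matrix (Fin n) (Fin d) ℝ) (s : Fin d → ℝ) : Fin d → ℝ :=
  lamex • (Vᵀ * V).mulVec s

/-- Gradient of the augmented Lagrangian with respect to U. -/
def gradUL {m n d : ℕ} (R : Matrix (Fin m) (Fin n) ℝ) (α₀ : ℝ) (lamU : Fin m → ℝ) (ρ : ℝ)
    (V : Matrix (Fin n) (Fin d) ℝ) (U : Matrix (Fin m) (Fin d) ℝ) (s w : Fin d → ℝ) :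
    Matrix (Fin m) (Fin d) ℝ :=
  Matrix.of fun i => gradU R α₀ lamU V U i + (ρ / (m : ℝ)) • (avgRow U - s + w)

/-- Gradient of the augmented Lagrangian with respect to s:
λ_ex VᵀV s − ρ((1/m)Uᵀ𝟙 − s + w). -/
def gradSL {m n d : ℕ} (lamex ρ : ℝ)
    (V : Matrix (Fin n) (Fin d) ℝ) (U : Matrix (Fin m) (Fin d) ℝ) (s w : Fin d → ℝ) :
    Fin d → ℝ :=
  gradS lamex V s - ρ • (avgRow U - s + w)

/-- Gradient of the augmented Lagrangian with respect to w: ρ((1/m)Uᵀ𝟙 − s). -/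
def gradWL {m d : ℕ} (ρ : ℝ) (U : Matrix (Fin m) (Fin d) ℝ) (s : Fin d → ℝ) : Fin d → ℝ :=
  ρ • (avgRow U - s)

lemma vecSq_eq_norm_sq {a : ℕ} (x : Fin a → ℝ) : vecSq x = ‖WithLp.toLp 2 x‖ ^ 2 := by
  simp [vecSq, EuclideanSpace.norm_sq_eq]

lemma frobSq_eq_sum_vecSq {a b : ℕ} (A : Matrix (Fin a) (Fin b) ℝ) :
    frobSq A = ∑ i, vecSq (A i) := rfl

lemma frobSq_nonneg {a b : ℕ} (A : Matrix (Fin a) (Fin b) ℝ) : 0 ≤ frobSq A :=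
  sum_nonneg fun _ _ => sum_nonneg fun _ _ => sq_nonneg _

/-- A nonnegatively weighted Gram operator plus a multiple of the identity is bounded by
the largest weight times the squared Frobenius norm plus the multiple. -/
lemma norm_weighted_gram_add_smul_le {n : ℕ} {E : Type*} [NormedAddCommGroup E]
    [InnerProductSpace ℝ E] (v : Fin n → E) (w : Fin n → ℝ) (c l L : ℝ)
    (hw : ∀ j, 0 ≤ w j) (hwc : ∀ j, w j ≤ c) (hl : 0 ≤ l) (hlL : l ≤ L) (x : E) :
    ‖(∑ j, (w j * inner ℝ (v j) x) • v j) + l • x‖ ≤ (c * ∑ j, ‖v j‖ ^ 2 + L) * ‖x‖ := by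
  refine (norm_add_le _ _).trans ?_
  rw [add_mul, mul_sum, sum_mul]
  refine add_le_add ((norm_sum_le _ _).trans (sum_le_sum fun j _ => ?_)) ?_
  · rw [norm_smul, norm_mul, Real.norm_of_nonneg (hw j)]
    calc w j * ‖inner ℝ (v j) x‖ * ‖v j‖ ≤ c * (‖v j‖ * ‖x‖) * ‖v j‖ := by
          have := hw j
          have := (hw j).trans (hwc j)
          gcongr
          · exact hwc j
          · exact norm_inner_le_norm _ _
      _ = c * ‖v j‖ ^ 2 * ‖x‖ := by ring
  · rw [norm_smul, Real.norm_of_nonneg hl]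
    gcongr

lemma toLp_gradU_sub_row {m n d : ℕ} (R : Matrix (Fin m) (Fin n) ℝ) (α₀ : ℝ)
    (lamU : Fin m → ℝ) (V : Matrix (Fin n) (Fin d) ℝ) (U U' : Matrix (Fin m) (Fin d) ℝ)
    (i : Fin m) :
    WithLp.toLp 2 ((gradU R α₀ lamU V U - gradU R α₀ lamU V U') i) =
      (∑ j, ((R i j + α₀) * inner ℝ (WithLp.toLp 2 (V j)) (WithLp.toLp 2 ((U - U') i))) •
        WithLp.toLp 2 (V j)) + lamU i • WithLp.toLp 2 ((U - U') i) := by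
  have hgram : Vᵀ * V = ∑ j, vecMulVec (V j) (V j) := by
    ext k l
    simp [Matrix.mul_apply, Matrix.sum_apply, vecMulVec_apply]
  have hrow : (gradU R α₀ lamU V U - gradU R α₀ lamU V U') i =
      ((∑ j, R i j • vecMulVec (V j) (V j)) + α₀ • (Vᵀ * V)
        + (lamU i) • (1 : Matrix (Fin d) (Fin d) ℝ)).mulVec ((U - U') i) := by
    change _ - _ - (_ - _) = Matrix.mulVec _ (U i - U' i)
    rw [Matrix.mulVec_sub, sub_sub_sub_cancel_right]
  rw [hrow, hgram, smul_sum, ← sum_add_distrib]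
  simp_rw [← add_smul]
  ext k
  simp [Matrix.add_mulVec, Matrix.sum_mulVec, Matrix.smul_mulVec, vecMulVec_mulVec,
    EuclideanSpace.inner_eq_star_dotProduct, dotProduct_comm, mul_comm]
  exact sum_congr rfl fun j _ => mul_left_comm _ _ _

/-- Lipschitz bound for ∇_U g (which does not depend on s). -/
theorem gradU_lipschitz {m n d : ℕ} (hm : 1 ≤ m) (hn : 1 ≤ n) (hd : 1 ≤ d)
    (R : Matrix (Fin m) (Fin n) ℝ) (hR : ∀ i j, R i j = 0 ∨ R i j = 1)
    (α₀ lamex : ℝ) (hα : 0 < α₀) (hlamex : 0 < lamex)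
    (lamU : Fin m → ℝ) (lamV : Fin n → ℝ)
    (hlamU : ∀ i, 0 < lamU i) (hlamV : ∀ j, 0 < lamV j)
    (lamUbar : ℝ) (hUbar : IsGreatest (Set.range lamU) lamUbar)
    (V : Matrix (Fin n) (Fin d) ℝ) (s s' : Fin d → ℝ)
    (U U' : Matrix (Fin m) (Fin d) ℝ) :
    frobNorm (gradU R α₀ lamU V U - gradU R α₀ lamU V U')
      ≤ Real.sqrt m * ((1 + α₀) * frobSq V + lamUbar) * frobNorm (U - U') := by
  have hL : ∀ i, lamU i ≤ lamUbar := fun i => hUbar.2 ⟨i, rfl⟩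
  have hLnn : 0 ≤ lamUbar := (hlamU ⟨0, hm⟩).le.trans (hL _)
  have hF := frobSq_nonneg V
  set C := (1 + α₀) * frobSq V + lamUbar with hC
  have hCnn : 0 ≤ C := by positivity
  have hrow : ∀ i, vecSq ((gradU R α₀ lamU V U - gradU R α₀ lamU V U') i)
      ≤ C ^ 2 * vecSq ((U - U') i) := by
    intro i
    have hR0 : ∀ j, 0 ≤ R i j + α₀ := fun j => by rcases hR i j with h | h <;> linarith
    have hR1 : ∀ j, R i j + α₀ ≤ 1 + α₀ := fun j => by rcases hR i j with h | h <;> linarith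
    rw [vecSq_eq_norm_sq, vecSq_eq_norm_sq, ← mul_pow, toLp_gradU_sub_row, hC,
      frobSq_eq_sum_vecSq]
    simp_rw [vecSq_eq_norm_sq]
    exact pow_le_pow_left₀ (norm_nonneg _)
      (norm_weighted_gram_add_smul_le _ _ _ _ _ hR0 hR1 (hlamU i).le (hL i) _) 2
  have hbound : frobNorm (gradU R α₀ lamU V U - gradU R α₀ lamU V U')
      ≤ C * frobNorm (U - U') := by
    unfold frobNorm
    rw [← Real.sqrt_sq hCnn, ← Real.sqrt_mul (sq_nonneg C)]
    refine Real.sqrt_le_sqrt ?_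
    rw [frobSq_eq_sum_vecSq, frobSq_eq_sum_vecSq, mul_sum]
    exact sum_le_sum fun i _ => hrow i
  have hsqrt : 1 ≤ Real.sqrt m := Real.one_le_sqrt.2 (by exact_mod_cast hm)
  refine hbound.trans (mul_le_mul_of_nonneg_right ?_ (Real.sqrt_nonneg _))
  exact le_mul_of_one_le_left hCnn hsqrt
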